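/- q-analogue of Lindström's Lemma: Let C be an m×n Cauchon diagram and let I ⊆ [m], J ⊆ [n] with |I| = |J| = k. Then det_q(M_C[I,J]) = Σ_P w(P), where the sum is over all VERTEX-DISJOINT (R_I,C_J)-path systems P in the Cauchon graph G_C. -/

import Mathlib

universe u

/-- Quantum affine space data: a central unit `q` and units `t i j`
satisfying the quantum affine space commutation relations. -/
structure QMData (R : Type u) [Ring R] (m n : ℕ) where
  q : Rˣ
  t : Fin m → Fin n → Rˣ
  q_central : ∀ r : R, (q : R) * r = r * (q : R)
  row_rel : ∀ (i : Fin m) ⦃j j' : Fin n⦄, j < j' →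
    (t i j : R) * (t i j' : R) = (q : R) * ((t i j' : R) * (t i j : R))
  col_rel : ∀ ⦃i i' : Fin m⦄ (j : Fin n), i < i' →
    (t i j : R) * (t i' j : R) = (q : R) * ((t i' j : R) * (t i j : R))
  mixed_rel : ∀ ⦃i i' : Fin m⦄ ⦃j j' : Fin n⦄, i < i' → j ≠ j' →
    (t i j : R) * (t i' j' : R) = (t i' j' : R) * (t i j : R)

/-- `white i j = true` means the square `(i,j)` is white.  The Cauchon
condition: for every black square, either every square above it or every
square to its left is also black. -/
def IsCauchon {m n : ℕ} (white : Fin m → Fin n → Bool) : Prop :=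
  ∀ i j, white i j = false →
    (∀ i' : Fin m, i' < i → white i' j = false) ∨
    (∀ j' : Fin n, j' < j → white i j' = false)

/-- Vertices of the Cauchon graph: white squares, row vertices `r_i`,
column vertices `c_j`. -/
inductive CVertex (m n : ℕ) where
  | sq : Fin m → Fin n → CVertex m n
  | row : Fin m → CVertex m n
  | col : Fin n → CVertex m n
deriving DecidableEq

/-- Directed edges of the Cauchon graph. -/
inductive CEdge {m n : ℕ} (white : Fin m → Fin n → Bool) :
    CVertex m n → CVertex m n → Prop where
  | fromRow (i : Fin m) (k : Fin n) :
      white i k = true → (∀ k' : Fin n, k < k' → white i k' = false) →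
      CEdge white (.row i) (.sq i k)
  | toCol (i : Fin m) (j : Fin n) :
      white i j = true → (∀ i' : Fin m, i < i' → white i' j = false) →
      CEdge white (.sq i j) (.col j)
  | horiz (i : Fin m) (k j : Fin n) :
      j < k → white i k = true → white i j = true →
      (∀ j' : Fin n, j < j' → j' < k → white i j' = false) →
      CEdge white (.sq i k) (.sq i j)
  | vert (i i' : Fin m) (j : Fin n) :
      i < i' → white i j = true → white i' j = true →
      (∀ l : Fin m, i < l → l < i' → white l j = false) →
      CEdge white (.sq i j) (.sq i' j)

/-- The weight of an edge of the Cauchon graph (1 on non-edges). -/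
def wt {R : Type u} {m n : ℕ} [Ring R] (D : QMData R m n) :
    CVertex m n → CVertex m n → R
  | .row i, .sq i' k => if i = i' then (D.t i' k : R) else 1
  | .sq i k, .sq i' j =>
      if i = i' ∧ j < k then (↑((D.t i k)⁻¹) * ↑(D.t i j) : R) else 1
  | _, _ => 1

/-- A pair of vertices spans a horizontal edge (edges from `r_i` are
horizontal; edges between squares are horizontal iff the rows agree). -/
def Horiz {m n : ℕ} : CVertex m n → CVertex m n → Prop
  | .row _, _ => True
  | .sq i _, .sq i' _ => i = i'
  | _, _ => False

/-- `l` is (the list of vertices of) a directed path from `u` to `v`. -/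
def IsPathFrom {m n : ℕ} (white : Fin m → Fin n → Bool) (u v : CVertex m n)
    (l : List (CVertex m n)) : Prop :=
  l.Chain' (CEdge white) ∧ l.head? = some u ∧ l.getLast? = some v

/-- The list of (endpoint pairs of the) edges of a path. -/
def steps {m n : ℕ} (l : List (CVertex m n)) : List (CVertex m n × CVertex m n) :=
  l.zip l.tail

/-- The weight of a path: the ordered product of its edge weights. -/
def pathWeight {R : Type u} {m n : ℕ} [Ring R] (D : QMData R m n)
    (l : List (CVertex m n)) : R :=
  ((steps l).map fun p => wt D p.1 p.2).prod

/-- The number of inversions (length) of a permutation of `Fin k`. -/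
def invCount {k : ℕ} (σ : Equiv.Perm (Fin k)) : ℕ :=
  ((Finset.univ : Finset (Fin k × Fin k)).filter fun p => p.1 < p.2 ∧ σ p.2 < σ p.1).card

/-- The quantum determinant of a `k × k` matrix over a (noncommutative) ring. -/
def qdet {R : Type u} [Ring R] {k : ℕ} (q : Rˣ) (N : Matrix (Fin k) (Fin k) R) : R :=
  ∑ σ : Equiv.Perm (Fin k),
    (-(q : R)) ^ invCount σ * ((List.finRange k).map fun i => N i (σ i)).prod

/-- The path matrix: entry `(i,j)` is the sum of the weights of all directed
paths from `r_i` to `c_j` (zero when there are none). -/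
noncomputable def pathMatrix {R : Type u} {m n : ℕ} [Ring R] (D : QMData R m n)
    (white : Fin m → Fin n → Bool) : Matrix (Fin m) (Fin n) R :=
  Matrix.of fun i j =>
    ∑ᶠ p : {l : List (CVertex m n) // IsPathFrom white (.row i) (.col j) l},
      pathWeight D p.1

/-- An `(R_I, C_J)`-path system: paths `P ℓ : r_{i_ℓ} ⇒ c_{j_{σ ℓ}}`. -/
structure PathSys {m n : ℕ} (white : Fin m → Fin n → Bool) {k : ℕ}
    (ι : Fin k → Fin m) (κ : Fin k → Fin n) where
  σ : Equiv.Perm (Fin k)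
  P : Fin k → List (CVertex m n)
  isPath : ∀ l : Fin k, IsPathFrom white (.row (ι l)) (.col (κ (σ l))) (P l)

/-- A path system is vertex-disjoint if no two of its paths share a vertex. -/
def PathSys.VertexDisjoint {m n : ℕ} {white : Fin m → Fin n → Bool} {k : ℕ}
    {ι : Fin k → Fin m} {κ : Fin k → Fin n} (S : PathSys white ι κ) : Prop :=
  ∀ a b : Fin k, a ≠ b → ∀ x : CVertex m n, x ∈ S.P a → x ∈ S.P b → False

/-- The weight of a path system: the ordered product `w(P₁)⋯w(P_k)`. -/
def PathSys.weight {R : Type u} {m n : ℕ} [Ring R] (D : QMData R m n)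
    {white : Fin m → Fin n → Bool} {k : ℕ} {ι : Fin k → Fin m} {κ : Fin k → Fin n}
    (S : PathSys white ι κ) : R :=
  ((List.finRange k).map fun l => pathWeight D (S.P l)).prod

/-- The `q`-sign of a path system: `(-q) ^ ℓ(σ_P)`. -/
def PathSys.sgnq {R : Type u} {m n : ℕ} [Ring R] (D : QMData R m n)
    {white : Fin m → Fin n → Bool} {k : ℕ} {ι : Fin k → Fin m} {κ : Fin k → Fin n}
    (S : PathSys white ι κ) : R :=
  (-(D.q : R)) ^ invCount S.σ


namespace CauchonGraph

/-- Inductive form of `IsPathFrom`. -/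
inductive GPath {m n : ℕ} (white : Fin m → Fin n → Bool) :
    CVertex m n → CVertex m n → List (CVertex m n) → Prop where
  | nil (v : CVertex m n) : GPath white v v [v]
  | cons {u w v : CVertex m n} {l : List (CVertex m n)} :
      CEdge white u w → GPath white w v l → GPath white u v (u :: l)

theorem isPathFrom_iff {m n : ℕ} {white : Fin m → Fin n → Bool} {u v : CVertex m n}
    {l : List (CVertex m n)} : IsPathFrom white u v l ↔ GPath white u v l := by
  constructor
  · induction l generalizing u with
    | nil => rintro ⟨-, h, -⟩; simp at h
    | cons a l ih =>
      rintro ⟨hc, hh, hl⟩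
      simp only [List.head?_cons, Option.some.injEq] at hh
      subst hh
      cases l with
      | nil =>
        simp only [List.getLast?_singleton, Option.some.injEq] at hl
        subst hl
        exact .nil _
      | cons b l =>
        have hc' := List.isChain_cons_cons.1 hc
        exact .cons hc'.1 (ih ⟨hc'.2, rfl, by simpa [List.getLast?_cons_cons] using hl⟩)
  · intro h
    induction h with
    | nil v => exact ⟨List.isChain_singleton _, rfl, rfl⟩
    | @cons u w v l e h ih =>
      obtain ⟨hc, hh, hl⟩ := ih
      cases h with
      | nil => exact ⟨List.isChain_cons_cons.2 ⟨e, hc⟩, rfl, by simp [List.getLast?_cons_cons]⟩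
      | cons _ _ =>
        exact ⟨List.isChain_cons_cons.2 ⟨e, hc⟩, rfl, by simpa [List.getLast?_cons_cons] using hl⟩

theorem GPath.mem_head {m n : ℕ} {white : Fin m → Fin n → Bool} {u v : CVertex m n}
    {l : List (CVertex m n)} (h : GPath white u v l) : u ∈ l := by
  cases h <;> simp

theorem GPath.append {m n : ℕ} {white : Fin m → Fin n → Bool} {u x v : CVertex m n}
    {A K : List (CVertex m n)} (hA : GPath white u x (A ++ [x])) (hK : GPath white x v (x :: K)) :
    GPath white u v (A ++ x :: K) := by
  induction A generalizing u with
  | nil =>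
    cases hA with
    | nil => exact hK
    | cons _ h => cases h
  | cons a A ih =>
    rw [List.cons_append] at hA ⊢
    generalize hB : A ++ [x] = B at hA
    cases hA with
    | nil => simp at hB
    | cons e h => exact .cons e (ih (hB ▸ h))

theorem GPath.exists_split {m n : ℕ} {white : Fin m → Fin n → Bool} {u x v : CVertex m n}
    {l : List (CVertex m n)} (h : GPath white u v l) (hx : x ∈ l) :
    ∃ A K, l = A ++ x :: K ∧ GPath white u x (A ++ [x]) ∧ GPath white x v (x :: K) := by
  induction h with
  | nil v =>
    obtain rfl : x = v := by simpa using hx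
    exact ⟨[], [], rfl, .nil _, .nil _⟩
  | @cons u w v l e h ih =>
    rcases List.mem_cons.1 hx with rfl | hx
    · exact ⟨[], l, rfl, .nil _, .cons e h⟩
    · obtain ⟨A, K, rfl, hA, hK⟩ := ih hx
      exact ⟨u :: A, K, rfl, .cons e hA, hK⟩

/-- The row at which a vertex is drawn; column vertices lie below all rows. -/
def posRow {m n : ℕ} : CVertex m n → ℕ
  | .sq i _ => i
  | .row i => i
  | .col _ => m

/-- The column at which a vertex is drawn; row vertices lie to the right of all columns. -/
def posCol {m n : ℕ} : CVertex m n → ℕ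
  | .sq _ j => j
  | .row _ => n
  | .col j => j

/-- A rank function increasing along edges of the Cauchon graph. -/
def rank {m n : ℕ} : CVertex m n → ℕ
  | .sq i j => i * n + (n - 1 - j) + 1
  | .row _ => 0
  | .col _ => m * n + 1

theorem succ_mul_le {a b n : ℕ} (h : a < b) : a * n + n ≤ b * n := by
  have := Nat.mul_le_mul_right n (Nat.succ_le_of_lt h)
  rwa [Nat.succ_mul] at this

theorem rank_lt_of_edge {m n : ℕ} {white : Fin m → Fin n → Bool} {u v : CVertex m n}
    (h : CEdge white u v) : rank u < rank v := by
  cases h with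
  | fromRow i k => simp [rank]
  | toCol i j =>
    have := succ_mul_le (n := n) i.2
    simp only [rank]; omega
  | horiz i k j hjk =>
    simp only [rank]; omega
  | vert i i' j hii =>
    have := succ_mul_le (n := n) (Fin.lt_def.1 hii)
    simp only [rank]; omega

theorem sq_eq_of_rank_eq {m n : ℕ} {i i' : Fin m} {j j' : Fin n}
    (h : rank (.sq i j : CVertex m n) = rank (.sq i' j')) :
    (.sq i j : CVertex m n) = .sq i' j' := by
  simp only [rank] at h
  rcases lt_trichotomy i i' with hi | rfl | hi
  · have := succ_mul_le (n := n) (Fin.lt_def.1 hi)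
    omega
  · have : j = j' := by omega
    rw [this]
  · have := succ_mul_le (n := n) (Fin.lt_def.1 hi)
    omega

theorem GPath.rank_lt {m n : ℕ} {white : Fin m → Fin n → Bool} {u v : CVertex m n}
    {l : List (CVertex m n)} (h : GPath white u v (u :: l)) : ∀ y ∈ l, rank u < rank y := by
  generalize hl : u :: l = l' at h
  induction h generalizing l with
  | nil v => cases hl; simp
  | @cons u w v l' e h ih =>
    obtain rfl : l = l' := by simpa using hl
    intro y hy
    have hr := rank_lt_of_edge e
    cases h with
    | nil =>
      obtain rfl : y = w := by simpa using hy
      exact hr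
    | cons e' h' =>
      rcases List.mem_cons.1 hy with rfl | hy
      · exact hr
      · exact hr.trans (ih rfl y hy)

theorem GPath.rank_lt_last {m n : ℕ} {white : Fin m → Fin n → Bool} {u x : CVertex m n}
    {A : List (CVertex m n)} (h : GPath white u x (A ++ [x])) : ∀ y ∈ A, rank y < rank x := by
  induction A generalizing u with
  | nil => simp
  | cons a A ih =>
    intro y hy
    generalize hB : A ++ [x] = B
    rw [List.cons_append, hB] at h
    cases h with
    | nil => simp at hB
    | cons e h =>
      rcases List.mem_cons.1 hy with rfl | hy
      · refine GPath.rank_lt (.cons e h) x ?_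
        simp [← hB]
      · exact ih (hB ▸ h) y hy

theorem GPath.notMem_of_append {m n : ℕ} {white : Fin m → Fin n → Bool} {u x : CVertex m n}
    {A : List (CVertex m n)} (h : GPath white u x (A ++ [x])) : x ∉ A :=
  fun hx => lt_irrefl _ (h.rank_lt_last x hx)

theorem GPath.nodup {m n : ℕ} {white : Fin m → Fin n → Bool} {u v : CVertex m n}
    {l : List (CVertex m n)} (h : GPath white u v l) : l.Nodup := by
  induction h with
  | nil => simp
  | cons e h ih =>
    exact List.nodup_cons.2 ⟨fun hu => lt_irrefl _ ((GPath.cons e h).rank_lt _ hu), ih⟩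

theorem GPath.eq_of_row_mem {m n : ℕ} {white : Fin m → Fin n → Bool} {u v : CVertex m n}
    {l : List (CVertex m n)} (h : GPath white u v l) {i : Fin m} (hi : .row i ∈ l) :
    u = .row i := by
  induction h with
  | nil => simpa [eq_comm] using hi
  | cons e h ih =>
    rcases List.mem_cons.1 hi with h' | h'
    · exact h'.symm
    · have := ih h'
      subst this
      cases e

theorem GPath.eq_of_col_mem {m n : ℕ} {white : Fin m → Fin n → Bool} {u v : CVertex m n}
    {l : List (CVertex m n)} (h : GPath white u v l) {j : Fin n} (hj : .col j ∈ l) :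
    v = .col j := by
  induction h with
  | nil => simpa [eq_comm] using hj
  | cons e h ih =>
    rcases List.mem_cons.1 hj with h' | h'
    · subst h'
      cases e
    · exact ih h'

theorem GPath.bounds {m n : ℕ} {white : Fin m → Fin n → Bool} {u v : CVertex m n}
    {l : List (CVertex m n)} (h : GPath white u v l) {y : CVertex m n} (hy : y ∈ l) :
    posRow u ≤ posRow y ∧ posCol y ≤ posCol u := by
  induction h with
  | nil =>
    obtain rfl : y = _ := by simpa using hy
    simp
  | cons e h ih =>
    rcases List.mem_cons.1 hy with rfl | hy
    · simp
    · have := ih hy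
      cases e <;> simp only [posRow, posCol] at this ⊢ <;> omega

/-! ### Planarity -/

theorem lt_or_eq_of_horiz_gap {m n : ℕ} {white : Fin m → Fin n → Bool} (hC : IsCauchon white)
    {i i' : Fin m} {c j : Fin n} {k : ℕ} (hi : i ≤ i') (hw : white i c = true)
    (hv : ∀ l, i < l → l ≤ i' → white l c = false) (hj : white i' j = true)
    (hh : ∀ j' : Fin n, j < j' → (j' : ℕ) < k → white i' j' = false) (hck : (c : ℕ) < k) :
    c < j ∨ (i = i' ∧ j = c) := by
  rcases lt_trichotomy c j with h | rfl | h
  · exact .inl h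
  · rcases hi.lt_or_eq with hi | hi
    · have := hv i' hi le_rfl
      simp_all
    · exact .inr ⟨hi, rfl⟩
  · exfalso
    rcases hi.lt_or_eq with hi | rfl
    · rcases hC i' c (hv i' hi le_rfl) with h' | h'
      · have := h' i hi
        simp_all
      · have := h' j h
        simp_all
    · have := hh c h hck
      simp_all

theorem end_lt_end {m n : ℕ} {white : Fin m → Fin n → Bool} (hC : IsCauchon white) (N : ℕ)
    {u v : CVertex m n} {a b : Fin n} {K L : List (CVertex m n)} (hN : K.length + L.length ≤ N)
    (hK : GPath white u (.col a) K) (hL : GPath white v (.col b) L)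
    (hd : ∀ y ∈ K, y ∉ L) (hr : posRow u ≤ posRow v) (hc : posCol u < posCol v) : a < b := by
  induction N generalizing u v K L with
  | zero =>
    have := List.length_pos_of_mem hK.mem_head
    omega
  | succ N ih =>
    cases hK with
    | nil =>
      cases hL with
      | nil => exact hc
      | cons e _ => cases e <;> simp only [posRow] at hr <;> omega
    | @cons _ w _ K e hK =>
      by_cases hw : posRow w ≤ posRow v
      · refine ih (by simp at hN; omega) hK hL (fun y hy => hd y (by simp [hy])) hw ?_
        cases e <;> cases v <;> simp only [posCol] at hc ⊢ <;> omega
      · cases hL with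
        | nil => cases w <;> simp only [posRow] at hw <;> omega
        | @cons _ z _ L e' hL =>
          have hz := hL.mem_head
          have key : posRow u ≤ posRow z ∧ posCol u < posCol z := by
            obtain ⟨i, c, rfl, hwi, hg⟩ : ∃ i c, u = .sq i c ∧ white i c = true ∧
                ∀ l : Fin m, i < l → (l : ℕ) < posRow w → white l c = false := by
              cases e with
              | fromRow i k => cases v <;> simp only [posCol] at hc <;> omega
              | toCol i j h1 h2 => exact ⟨i, j, rfl, h1, fun l hl _ => h2 l hl⟩
              | horiz => simp only [posRow] at hw hr; omega
              | vert i i' j h1 h2 h3 h4 => exact ⟨i, j, rfl, h2, fun l hl hl' => h4 l hl hl'⟩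
            have hu : (.sq i c : CVertex m n) ≠ z := by
              rintro rfl
              exact hd (.sq i c) (by simp) (by simp [hz])
            cases e' with
            | fromRow i' k h1 h2 =>
              simp only [posRow] at hr hw ⊢
              simp only [posCol]
              rcases lt_or_eq_of_horiz_gap (k := n) hC (Fin.le_def.2 hr) hwi
                (fun l hl hl' => hg l hl ((Fin.le_def.1 hl').trans_lt (not_le.1 hw))) h1
                (fun j' hj' _ => h2 j' hj') c.2 with h | ⟨rfl, rfl⟩
              · exact ⟨hr, h⟩
              · exact absurd rfl hu
            | horiz i' k j hjk h1 h2 h3 =>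
              simp only [posRow] at hr hw ⊢
              simp only [posCol] at hc ⊢
              rcases lt_or_eq_of_horiz_gap (k := k) hC (Fin.le_def.2 hr) hwi
                (fun l hl hl' => hg l hl ((Fin.le_def.1 hl').trans_lt (not_le.1 hw))) h2
                (fun j' hj' h => h3 j' hj' h) hc with h | ⟨rfl, rfl⟩
              · exact ⟨hr, h⟩
              · exact absurd rfl hu
            | toCol i' j => simp only [posRow, posCol] at hr hc ⊢; omega
            | vert i' i'' j h => simp only [posRow, posCol] at hr hc ⊢; omega
          exact ih (by simp at hN ⊢; omega) (.cons e hK) hL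
            (fun y hy hy' => hd y hy (by simp [hy'])) key.1 key.2

theorem end_outside {m n : ℕ} {white : Fin m → Fin n → Bool} (hC : IsCauchon white)
    {i : Fin m} {c o a b e : Fin n} {K L P : List (CVertex m n)} {u : CVertex m n}
    (hwc : white i c = true) (hwo : white i o = true)
    (hg : ∀ j' : Fin n, o < j' → j' < c → white i j' = false)
    (hK : GPath white (.sq i o) (.col a) K) (hL : GPath white (.sq i c) (.col b) L)
    (hP : GPath white u (.col e) P) (hPK : ∀ y ∈ P, y ∉ K) (hPL : ∀ y ∈ P, y ∉ L)
    (hu : posRow u < i ∨ c < posCol u) : e < a ∨ b < e := by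
  generalize hv : (.col e : CVertex m n) = v at hP
  induction hP with
  | nil v =>
    subst hv
    refine .inr (end_lt_end hC _ le_rfl hL (.nil (.col e)) (fun y hy hy' => hPL y hy' hy) ?_ ?_)
    · simp only [posRow]; omega
    · rcases hu with h | h
      · simp only [posRow] at h; omega
      · simpa [posCol] using h
  | @cons u w v P ed hP ih =>
    subst hv
    by_cases hui : posRow u < i
    · by_cases hwi : posRow w < i
      · exact ih (fun y hy => hPK y (by simp [hy])) (fun y hy => hPL y (by simp [hy]))
          (.inl hwi) rfl
      · obtain ⟨i', p, rfl, hwi', hgap, hpw⟩ : ∃ i' p, u = .sq i' p ∧ white i' p = true ∧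
            (∀ l : Fin m, i' < l → (l : ℕ) < posRow w → white l p = false) ∧ posCol w = p := by
          cases ed with
          | fromRow i k => simp only [posRow] at hwi hui; omega
          | toCol i j h1 h2 => exact ⟨i, j, rfl, h1, fun l hl _ => h2 l hl, rfl⟩
          | horiz => simp only [posRow] at hwi hui; omega
          | vert i i' j h1 h2 h3 h4 => exact ⟨i, j, rfl, h2, fun l hl hl' => h4 l hl hl', rfl⟩
        have hii : i' < i := hui
        have hwmem := hP.mem_head
        have miss : ∀ y : Fin n, white i y = true → (.sq i y : CVertex m n) ∉ P → p ≠ y := by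
          rintro y hy hyP rfl
          rcases (not_lt.1 hwi).lt_or_eq with h | h
          · have := hgap i hii h
            simp_all
          · cases w with
            | sq r s =>
              simp only [posRow, posCol] at h hpw
              have h1 : i = r := Fin.ext h
              have h2 : s = p := Fin.ext hpw
              subst h1 h2
              exact hyP hwmem
            | row r => cases ed
            | col s => simp only [posRow] at h; omega
        have hpc := miss c hwc (fun h => hPL _ (List.mem_cons_of_mem _ h) hL.mem_head)
        have hpo := miss o hwo (fun h => hPK _ (List.mem_cons_of_mem _ h) hK.mem_head)
        rcases lt_or_gt_of_ne hpc with h | h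
        · left
          have hpo' : p < o := by
            rcases lt_or_gt_of_ne hpo with h' | h'
            · exact h'
            · exfalso
              rcases hC i p (hg p h' h) with h2 | h2
              · have := h2 i' hii
                simp_all
              · have := h2 o h'
                simp_all
          exact end_lt_end hC _ le_rfl (.cons ed hP) hK hPK hui.le hpo'
        · right
          refine end_lt_end hC _ le_rfl hL hP (fun y hy hy' => hPL y (by simp [hy']) hy)
            (not_lt.1 hwi) ?_
          rw [hpw]
          exact h
    · exact .inr (end_lt_end hC _ le_rfl hL (.cons ed hP) (fun y hy hy' => hPL y hy' hy)
        (not_lt.1 hui) (hu.resolve_left hui))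

/-! ### Commutation up to powers of `q` -/

/-- `a` and `b` commute up to the factor `q ^ e`. -/
def QComm {G : Type*} [Group G] (q : G) (e : ℤ) (a b : G) : Prop :=
  a * b = q ^ e * (b * a)

section QComm

variable {G : Type*} [Group G] {q : G}

theorem QComm.mul_left (hq : ∀ g, Commute q g) {e f : ℤ} {a b c : G} (h : QComm q e a c)
    (h' : QComm q f b c) : QComm q (e + f) (a * b) c := by
  unfold QComm at *
  rw [mul_assoc, h', ← mul_assoc, ← ((hq a).zpow_left f).eq, mul_assoc, ← mul_assoc a, h, add_comm,
    zpow_add]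
  simp only [mul_assoc]

theorem QComm.symm {e : ℤ} {a b : G} (h : QComm q e a b) :
    QComm q (-e) b a := by
  unfold QComm at *
  rw [h, ← mul_assoc, ← zpow_add]
  simp

theorem QComm.inv_left (hq : ∀ g, Commute q g) {e : ℤ} {a b : G} (h : QComm q e a b) :
    QComm q (-e) a⁻¹ b := by
  unfold QComm at *
  have h1 : q ^ e * (a⁻¹ * b) = b * a⁻¹ := by
    rw [← mul_assoc, ((hq a⁻¹).zpow_left e).eq, mul_assoc, inv_mul_eq_iff_eq_mul, ← mul_assoc,
      eq_mul_inv_iff_mul_eq, mul_assoc, h]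
  rw [← h1, ← mul_assoc, ← zpow_add]
  simp

theorem QComm.mul_right (hq : ∀ g, Commute q g) {e f : ℤ} {a b c : G} (h : QComm q e a b)
    (h' : QComm q f a c) : QComm q (e + f) a (b * c) := by
  have := ((h.symm).mul_left hq (h'.symm)).symm
  rwa [neg_add_rev, neg_neg, neg_neg, add_comm] at this

theorem QComm.inv_right (hq : ∀ g, Commute q g) {e : ℤ} {a b : G} (h : QComm q e a b) :
    QComm q (-e) a b⁻¹ := by
  have := ((h.symm).inv_left hq).symm
  simpa using this

theorem QComm.congr {e f : ℤ} {a b : G} (h : QComm q e a b) (hef : e = f) : QComm q f a b :=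
  hef ▸ h

theorem QComm.one_right {a : G} : QComm q 0 a 1 := by simp [QComm]

end QComm

/-- The exponent in the commutation relation between `t i j` and `t i' j'`. -/
def pairing {m n : ℕ} (i : Fin m) (j : Fin n) (i' : Fin m) (j' : Fin n) : ℤ :=
  if i = i' then (if j < j' then 1 else if j' < j then -1 else 0)
  else if j = j' then (if i < i' then 1 else -1) else 0

theorem commute_q {R : Type u} [Ring R] {m n : ℕ} (D : QMData R m n) (g : Rˣ) :
    Commute D.q g :=
  Units.ext (D.q_central g)

theorem qcomm_t {R : Type u} [Ring R] {m n : ℕ} (D : QMData R m n) (i : Fin m) (j : Fin n)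
    (i' : Fin m) (j' : Fin n) : QComm D.q (pairing i j i' j') (D.t i j) (D.t i' j') := by
  have hrow : ∀ (i : Fin m) {j j' : Fin n}, j < j' → QComm D.q 1 (D.t i j) (D.t i j') := by
    intro i j j' h
    refine Units.ext ?_
    simpa using D.row_rel i h
  have hcol : ∀ {i i' : Fin m} (j : Fin n), i < i' → QComm D.q 1 (D.t i j) (D.t i' j) := by
    intro i i' j h
    refine Units.ext ?_
    simpa using D.col_rel j h
  have hmix : ∀ {i i' : Fin m} {j j' : Fin n}, i < i' → j ≠ j' →
      QComm D.q 0 (D.t i j) (D.t i' j') := by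
    intro i i' j j' h h'
    refine Units.ext ?_
    simpa using D.mixed_rel h h'
  have hq := commute_q D
  rcases lt_trichotomy i i' with hi | rfl | hi
  · by_cases hj : j = j'
    · subst hj
      exact (hcol j hi).congr (by simp [pairing, hi, hi.ne])
    · exact (hmix hi hj).congr (by simp [pairing, hi.ne, hj])
  · rcases lt_trichotomy j j' with hj | rfl | hj
    · exact (hrow i hj).congr (by simp [pairing, hj])
    · simp [QComm, pairing]
    · exact ((hrow i hj).symm).congr (by simp [pairing, hj, hj.le])
  · by_cases hj : j = j'
    · subst hj
      exact ((hcol j hi).symm).congr (by simp [pairing, hi.ne', hi.le])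
    · exact ((hmix hi (Ne.symm hj)).symm).congr (by simp [pairing, hi.ne', hj])

/-- Edge weights as units. -/
def unitWt {R : Type u} {m n : ℕ} [Ring R] (D : QMData R m n) :
    CVertex m n → CVertex m n → Rˣ
  | .row i, .sq i' k => if i = i' then D.t i' k else 1
  | .sq i k, .sq i' j => if i = i' ∧ j < k then (D.t i k)⁻¹ * D.t i j else 1
  | _, _ => 1

/-- Path weights as units. -/
def unitPathWeight {R : Type u} {m n : ℕ} [Ring R] (D : QMData R m n) :
    List (CVertex m n) → Rˣ
  | [] => 1
  | [_] => 1
  | u :: v :: l => unitWt D u v * unitPathWeight D (v :: l)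

theorem coe_unitWt {R : Type u} {m n : ℕ} [Ring R] (D : QMData R m n) (u v : CVertex m n) :
    (unitWt D u v : R) = wt D u v := by
  cases u <;> cases v <;> simp only [unitWt, wt, Units.val_one] <;> split_ifs <;> simp

theorem coe_unitPathWeight {R : Type u} {m n : ℕ} [Ring R] (D : QMData R m n)
    (l : List (CVertex m n)) : (unitPathWeight D l : R) = pathWeight D l := by
  induction l with
  | nil => simp [unitPathWeight, pathWeight, steps]
  | cons u l ih =>
    cases l with
    | nil => simp [unitPathWeight, pathWeight, steps]
    | cons v l =>
      rw [unitPathWeight, Units.val_mul, ih, coe_unitWt]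
      simp [pathWeight, steps]

theorem unitPathWeight_append {R : Type u} {m n : ℕ} [Ring R] (D : QMData R m n)
    (A K : List (CVertex m n)) (x : CVertex m n) :
    unitPathWeight D (A ++ x :: K) = unitPathWeight D (A ++ [x]) * unitPathWeight D (x :: K) := by
  induction A with
  | nil => simp [unitPathWeight]
  | cons a A ih =>
    cases A with
    | nil => simp [unitPathWeight]
    | cons b A =>
      simp only [List.cons_append, unitPathWeight] at ih ⊢
      rw [ih, mul_assoc]

theorem GPath.unitPathWeight_cons {R : Type u} {m n : ℕ} [Ring R] (D : QMData R m n)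
    {white : Fin m → Fin n → Bool} {w v : CVertex m n} {l : List (CVertex m n)}
    (h : GPath white w v l) (u : CVertex m n) :
    unitPathWeight D (u :: l) = unitWt D u w * unitPathWeight D l := by
  cases h <;> rfl

theorem GPath.qcomm_t_mul {R : Type u} {m n : ℕ} [Ring R] (D : QMData R m n)
    {white : Fin m → Fin n → Bool} {u : CVertex m n} {e : Fin n} {l : List (CVertex m n)}
    (h : GPath white u (.col e) l) {r : Fin m} {c : Fin n} (hu : u = .sq r c) {i : Fin m}
    {y : Fin n} (hw : white i y = true) :
    QComm D.q (2 * (if (.sq i y : CVertex m n) ∈ l ∨ (i = r ∧ c < y) then 1 else 0)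
      - (if e = y then 1 else 0) - (if i = r then 1 else 0))
      (D.t r c * unitPathWeight D l) (D.t i y) := by
  have hq := commute_q D
  generalize hv : (.col e : CVertex m n) = v at h
  induction h generalizing r c with
  | nil => subst hv; cases hu
  | @cons u w v l ed h ih =>
    subst hv hu
    rw [h.unitPathWeight_cons]
    have hb : (.sq i y : CVertex m n) ∈ l → posRow w ≤ i ∧ y ≤ posCol w := fun hm => h.bounds hm
    have hm := h.mem_head
    cases ed with
    | toCol _ _ h1 h2 =>
      cases h with
      | cons ed _ => cases ed
      | nil =>
        simp only [unitWt, unitPathWeight, mul_one]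
        refine (CauchonGraph.qcomm_t D _ _ i y).congr ?_
        have := h2 i
        simp only [pairing, List.mem_cons, CVertex.sq.injEq, List.not_mem_nil, reduceCtorEq]
        grind
    | horiz _ _ d hdc h1 h2 h3 =>
      simp only [unitWt, hdc, and_self, if_true]
      rw [mul_assoc, mul_inv_cancel_left]
      refine (ih rfl rfl).congr ?_
      have := h3 y
      simp only [posRow, posCol] at hb
      simp only [List.mem_cons, CVertex.sq.injEq]
      grind
    | vert _ r' _ hr h1 h2 h3 =>
      simp only [unitWt, hr.ne, false_and, if_false, one_mul]
      have h4 := ((qcomm_t D r c i y).mul_left hq ((qcomm_t D r' c i y).inv_left hq)).mul_left hq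
        (ih rfl rfl)
      rw [mul_assoc, inv_mul_cancel_left] at h4
      refine h4.congr ?_
      have := h3 i
      simp only [posRow, posCol] at hb
      simp only [pairing, List.mem_cons, CVertex.sq.injEq]
      rcases lt_trichotomy i r with hi | rfl | hi <;>
      rcases lt_trichotomy i r' with hi' | rfl | hi' <;>
      rcases lt_trichotomy y c with hy | rfl | hy <;> grind

theorem GPath.qcomm_t {R : Type u} {m n : ℕ} [Ring R] (D : QMData R m n)
    {white : Fin m → Fin n → Bool} {r : Fin m} {e : Fin n} {l : List (CVertex m n)}
    (h : GPath white (.row r) (.col e) l) {i : Fin m} {y : Fin n} (hw : white i y = true) :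
    QComm D.q (2 * (if (.sq i y : CVertex m n) ∈ l then 1 else 0)
      - (if e = y then 1 else 0) - (if i = r then 1 else 0)) (unitPathWeight D l) (D.t i y) := by
  generalize hu : (.row r : CVertex m n) = u at h
  cases h with
  | nil => cases hu
  | cons ed h =>
    subst hu
    cases ed with
    | fromRow _ c h1 h2 =>
      rw [h.unitPathWeight_cons]
      simp only [unitWt, if_true]
      refine (h.qcomm_t_mul D rfl hw).congr ?_
      have := h2 y
      simp only [List.mem_cons, reduceCtorEq, false_or]
      grind

theorem GPath.qcomm_path {R : Type u} {m n : ℕ} [Ring R] (D : QMData R m n)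
    {white : Fin m → Fin n → Bool} {r : Fin m} {e a : Fin n} {p K : List (CVertex m n)}
    (hp : GPath white (.row r) (.col e) p) {w : CVertex m n} (hK : GPath white w (.col a) K)
    (hw : ∀ i, w ≠ .row i) (b : Prop)
    (hb : ∀ i j, (.sq i j : CVertex m n) ∈ K → ((.sq i j : CVertex m n) ∈ p ↔ b)) :
    QComm D.q ((if (e : ℕ) = posCol w then 1 else 0) - (if e = a then 1 else 0))
      (unitPathWeight D p) (unitPathWeight D K) := by
  have hq := commute_q D
  generalize hv : (.col a : CVertex m n) = v at hK
  induction hK with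
  | nil v =>
    subst hv
    exact QComm.one_right.congr (by simp only [posCol, Fin.ext_iff]; grind)
  | @cons w w' v K ed h ih =>
    subst hv
    rw [h.unitPathWeight_cons]
    have ih' := fun h => ih h (fun i j hij => hb i j (List.mem_cons_of_mem _ hij)) rfl
    cases ed with
    | fromRow i => exact absurd rfl (hw i)
    | toCol i j =>
      exact (QComm.one_right.mul_right hq (ih' (by simp))).congr (by simp only [posCol]; grind)
    | vert i i' j hi =>
      simp only [unitWt, hi.ne, false_and, if_false]
      exact (QComm.one_right.mul_right hq (ih' (by simp))).congr (by simp only [posCol]; grind)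
    | horiz i k j hjk h1 h2 =>
      simp only [unitWt, hjk, and_self, if_true]
      refine ((((hp.qcomm_t D h1).inv_right hq).mul_right hq (hp.qcomm_t D h2)).mul_right hq
        (ih' (by simp))).congr ?_
      have hb1 := hb i k (by simp)
      have hb2 := hb i j (List.mem_cons_of_mem _ h.mem_head)
      simp only [posCol, Fin.ext_iff]
      grind

/-! ### The last meeting vertex of a path system -/

/-- The path `K` is entered from `(i, c)` by a horizontal edge. -/
def GoesLeft {m n : ℕ} (white : Fin m → Fin n → Bool) (i : Fin m) (c e : Fin n)
    (K : List (CVertex m n)) : Prop :=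
  ∃ o, o < c ∧ white i c = true ∧ white i o = true ∧
    (∀ j' : Fin n, o < j' → j' < c → white i j' = false) ∧ GPath white (.sq i o) (.col e) K

/-- The path `K` is entered from `(i, c)` by a vertical edge. -/
def GoesDown {m n : ℕ} (white : Fin m → Fin n → Bool) (i : Fin m) (c e : Fin n)
    (K : List (CVertex m n)) : Prop :=
  ∃ w : CVertex m n, posCol w = c ∧ (i : ℕ) < posRow w ∧ CEdge white (.sq i c) w ∧
    GPath white w (.col e) K

theorem GPath.goesLeft_or_goesDown {m n : ℕ} {white : Fin m → Fin n → Bool} {i : Fin m}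
    {c e : Fin n} {K : List (CVertex m n)}
    (h : GPath white (.sq i c) (.col e) (.sq i c :: K)) :
    GoesLeft white i c e K ∨ GoesDown white i c e K := by
  cases h with
  | cons ed h =>
    cases ed with
    | toCol _ _ h1 h2 => exact .inr ⟨.col _, rfl, i.2, .toCol _ _ h1 h2, h⟩
    | horiz _ _ o h1 h2 h3 h4 => exact .inl ⟨o, h1, h2, h3, h4, h⟩
    | vert _ i' _ h1 h2 h3 h4 => exact .inr ⟨.sq i' _, rfl, h1, .vert _ _ _ h1 h2 h3 h4, h⟩

theorem GoesLeft.exists_common {m n : ℕ} {white : Fin m → Fin n → Bool} {i : Fin m}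
    {c e e' : Fin n} {K L : List (CVertex m n)} (hK : GoesLeft white i c e K)
    (hL : GoesLeft white i c e' L) : ∃ y, y ∈ K ∧ y ∈ L := by
  obtain ⟨o, h1, h2, h3, h4, h5⟩ := hK
  obtain ⟨o', h1', h2', h3', h4', h5'⟩ := hL
  obtain rfl : o = o' := by
    rcases lt_trichotomy o o' with h | h | h
    · have := h4 o' h h1'
      simp_all
    · exact h
    · have := h4' o h h1
      simp_all
  exact ⟨_, h5.mem_head, h5'.mem_head⟩

theorem GoesDown.exists_common {m n : ℕ} {white : Fin m → Fin n → Bool} {i : Fin m}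
    {c e e' : Fin n} {K L : List (CVertex m n)} (hK : GoesDown white i c e K)
    (hL : GoesDown white i c e' L) : ∃ y, y ∈ K ∧ y ∈ L := by
  obtain ⟨w, h1, h2, h3, h4⟩ := hK
  obtain ⟨w', h1', h2', h3', h4'⟩ := hL
  obtain rfl : w = w' := by
    cases h3 with
    | horiz => simp [posRow] at h2
    | toCol _ _ g1 g2 =>
      cases h3' with
      | horiz => simp [posRow] at h2'
      | toCol => rfl
      | vert _ i' _ f1 f2 f3 =>
        have := g2 i' f1
        simp_all
    | vert _ r _ g1 g2 g3 g4 =>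
      cases h3' with
      | horiz => simp [posRow] at h2'
      | toCol _ _ f1 f2 =>
        have := f2 r g1
        simp_all
      | vert _ r' _ f1 f2 f3 f4 =>
        rcases lt_trichotomy r r' with h | rfl | h
        · have := f4 r g1 h
          simp_all
        · rfl
        · have := g4 r' f1 h
          simp_all
  exact ⟨_, h4.mem_head, h4'.mem_head⟩

/-- `P` is a family of paths in the Cauchon graph from `r_{ι l}` to `c_{τ l}`. -/
def IsSystem {m n : ℕ} (white : Fin m → Fin n → Bool) {k : ℕ} (ι : Fin k → Fin m)
    (τ : Fin k → Fin n) (P : Fin k → List (CVertex m n)) : Prop :=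
  ∀ l, GPath white (.row (ι l)) (.col (τ l)) (P l)

/-- The paths `P a` and `P b` share `x`, and no shared vertex has larger rank. -/
def LastMeet {m n k : ℕ} (P : Fin k → List (CVertex m n)) (x : CVertex m n) (a b : Fin k) :
    Prop :=
  a ≠ b ∧ x ∈ P a ∧ x ∈ P b ∧ ∀ c d y, c ≠ d → y ∈ P c → y ∈ P d → rank y ≤ rank x

theorem LastMeet.symm {m n k : ℕ} {P : Fin k → List (CVertex m n)} {x : CVertex m n}
    {a b : Fin k} (h : LastMeet P x a b) : LastMeet P x b a :=
  ⟨h.1.symm, h.2.2.1, h.2.1, h.2.2.2⟩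

theorem exists_lastMeet {m n k : ℕ} {P : Fin k → List (CVertex m n)}
    (h : ∃ a b, a ≠ b ∧ ∃ x, x ∈ P a ∧ x ∈ P b) : ∃ x a b, a < b ∧ LastMeet P x a b := by
  classical
  let s : Finset (CVertex m n) :=
    (Finset.univ.biUnion fun a => (P a).toFinset).filter fun x =>
      ∃ a b, a ≠ b ∧ x ∈ P a ∧ x ∈ P b
  have hs : ∀ {x a b}, a ≠ b → x ∈ P a → x ∈ P b → x ∈ s := by
    intro x a b hab ha hb
    simp only [s, Finset.mem_filter, Finset.mem_biUnion, Finset.mem_univ, true_and,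
      List.mem_toFinset]
    exact ⟨⟨a, ha⟩, a, b, hab, ha, hb⟩
  obtain ⟨a, b, hab, x, hxa, hxb⟩ := h
  obtain ⟨y, hy, hmax⟩ := s.exists_max_image rank ⟨x, hs hab hxa hxb⟩
  obtain ⟨-, c, d, hcd, hc, hd⟩ := Finset.mem_filter.1 hy
  have hlm : LastMeet P y c d := ⟨hcd, hc, hd, fun _ _ z h h1 h2 => hmax z (hs h h1 h2)⟩
  rcases hcd.lt_or_gt with h | h
  · exact ⟨y, c, d, h, hlm⟩
  · exact ⟨y, d, c, h, hlm.symm⟩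

section LastMeet

variable {m n k : ℕ} {white : Fin m → Fin n → Bool} {ι : Fin k → Fin m} {τ : Fin k → Fin n}
  {P : Fin k → List (CVertex m n)} {x : CVertex m n} {a b : Fin k}

theorem LastMeet.exists_eq_sq (h : LastMeet P x a b) (hP : IsSystem white ι τ P)
    (hι : Function.Injective ι) (hτ : Function.Injective τ) : ∃ i c, x = .sq i c := by
  obtain ⟨hab, ha, hb, -⟩ := h
  cases x with
  | sq i c => exact ⟨i, c, rfl⟩
  | row i =>
    have h1 := (hP a).eq_of_row_mem ha
    have h2 := (hP b).eq_of_row_mem hb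
    exact absurd (hι (CVertex.row.inj (h1.trans h2.symm))) hab
  | col j =>
    have h1 := (hP a).eq_of_col_mem ha
    have h2 := (hP b).eq_of_col_mem hb
    exact absurd (hτ (CVertex.col.inj (h1.trans h2.symm))) hab

theorem LastMeet.disjoint_tails (h : LastMeet P x a b) {c d : Fin k} (hcd : c ≠ d)
    {u v : CVertex m n} {A K : List (CVertex m n)} (hc : P c = A ++ x :: K)
    (hK : GPath white u v (x :: K)) : ∀ y ∈ K, y ∉ P d := by
  intro y hy hyd
  obtain rfl : u = x := by cases hK <;> rfl
  exact absurd (h.2.2.2 c d y hcd (by simp [hc, hy]) hyd) (not_le.2 (hK.rank_lt y hy))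

theorem LastMeet.not_both (h : LastMeet P x a b) {c d : Fin k} (hcd : c ≠ d)
    {u v : CVertex m n} {A B K L : List (CVertex m n)} (hc : P c = A ++ x :: K)
    (hd : P d = B ++ x :: L) (hK : GPath white u v (x :: K)) (hKL : ∃ y, y ∈ K ∧ y ∈ L) :
    False := by
  obtain ⟨y, hy, hy'⟩ := hKL
  exact h.disjoint_tails hcd hc hK y hy (by simp [hd, hy'])

theorem LastMeet.notMem {i : Fin m} {c : Fin n} (h : LastMeet P (.sq i c) a b)
    (hP : IsSystem white ι τ P) {l : Fin k} (hla : l ≠ a) (hlb : l ≠ b) :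
    (.sq i c : CVertex m n) ∉ P l := by
  intro hl
  obtain ⟨A, K, hA, -, hK⟩ := (hP a).exists_split h.2.1
  obtain ⟨B, L, hB, -, hL⟩ := (hP b).exists_split h.2.2.1
  obtain ⟨E, F, hE, -, hF⟩ := (hP l).exists_split hl
  rcases hK.goesLeft_or_goesDown with h1 | h1 <;> rcases hL.goesLeft_or_goesDown with h2 | h2 <;>
  rcases hF.goesLeft_or_goesDown with h3 | h3
  all_goals first
    | exact h.not_both h.1 hA hB hK (h1.exists_common h2)
    | exact h.not_both hla hE hA hF (h3.exists_common h1)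
    | exact h.not_both hlb hE hB hF (h3.exists_common h2)

theorem LastMeet.unique (h : LastMeet P x a b) (hab : a < b) {x' : CVertex m n} {a' b' : Fin k}
    (h' : LastMeet P x' a' b') (hab' : a' < b') (hP : IsSystem white ι τ P)
    (hι : Function.Injective ι) (hτ : Function.Injective τ) : x = x' ∧ a = a' ∧ b = b' := by
  obtain ⟨i, c, rfl⟩ := h.exists_eq_sq hP hι hτ
  obtain ⟨i', c', rfl⟩ := h'.exists_eq_sq hP hι hτ
  have hx := sq_eq_of_rank_eq (le_antisymm (h'.2.2.2 _ _ _ h.1 h.2.1 h.2.2.1)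
    (h.2.2.2 _ _ _ h'.1 h'.2.1 h'.2.2.1))
  rw [← hx] at h'
  have h1 : a' = a ∨ a' = b := by
    by_contra! hne
    exact h.notMem hP hne.1 hne.2 h'.2.1
  have h2 : b' = a ∨ b' = b := by
    by_contra! hne
    exact h.notMem hP hne.1 hne.2 h'.2.2.1
  refine ⟨hx, ?_⟩
  rcases h1 with rfl | rfl <;> rcases h2 with rfl | rfl
  · exact absurd hab' (lt_irrefl _)
  · exact ⟨rfl, rfl⟩
  · exact absurd hab (not_lt.2 hab'.le)
  · exact absurd hab' (lt_irrefl _)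

end LastMeet

/-! ### Swapping tails -/

theorem invCount_mul_swap {k : ℕ} (σ : Equiv.Perm (Fin k)) {a b : Fin k} (hab : a < b)
    (hσ : σ a < σ b) (hl : ∀ l, l ≠ a → l ≠ b → σ l < σ a ∨ σ b < σ l) :
    invCount (σ * Equiv.swap a b) = invCount σ + 1 := by
  unfold invCount
  have hnot : (a, b) ∉ (Finset.univ : Finset (Fin k × Fin k)).filter
      fun p => p.1 < p.2 ∧ σ p.2 < σ p.1 := by
    simp [hab, hσ.le]
  rw [← Finset.card_insert_of_notMem hnot]
  congr 1
  ext ⟨c, d⟩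
  simp only [Finset.mem_filter, Finset.mem_univ, true_and, Finset.mem_insert, Prod.mk.injEq]
  simp only [Equiv.Perm.coe_mul, Function.comp_apply, Equiv.swap_apply_def]
  have hc := hl c
  have hd := hl d
  split_ifs <;> grind

theorem prod_eq_of_swap {G : Type*} [Group G] {q : G} (hq : ∀ g, Commute q g) {k : ℕ}
    {f f' : Fin k → G} {d : G} {a b : Fin k} (hab : a < b) (hfa : f' a = f a * d)
    (hfb : f b = f' b * d) (hb : QComm q 1 (f' b) d)
    (hf : ∀ l, l ≠ a → l ≠ b → f' l = f l ∧ Commute (f l) d) :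
    ((List.finRange k).map f).prod = q * ((List.finRange k).map f').prod := by
  obtain ⟨s, t, hst⟩ := List.append_of_mem (List.mem_finRange a)
  have hsort := List.pairwise_lt_finRange k
  have hnd := List.nodup_finRange k
  have hbt : b ∈ t := by
    have hb := List.mem_finRange b
    rw [hst] at hb hsort
    rcases List.mem_append.1 hb with h | h
    · exact absurd ((List.pairwise_append.1 hsort).2.2 b h a (by simp)) (not_lt.2 hab.le)
    · exact (List.mem_cons.1 h).resolve_left hab.ne'
  obtain ⟨t, v, rfl⟩ := List.append_of_mem hbt
  rw [hst] at hnd ⊢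
  have hmap : ∀ L : List (Fin k), (∀ l ∈ L, l ≠ a ∧ l ≠ b) → L.map f' = L.map f := fun L hL =>
    List.map_congr_left fun l h => (hf l (hL l h).1 (hL l h).2).1
  have hs : ∀ l ∈ s, l ≠ a ∧ l ≠ b := by grind
  have ht : ∀ l ∈ t, l ≠ a ∧ l ≠ b := by grind
  have hv : ∀ l ∈ v, l ≠ a ∧ l ≠ b := by grind
  have hcomm : Commute (t.map f).prod d := by
    refine Commute.list_prod_left _ _ fun y hy => ?_
    obtain ⟨l, hl, rfl⟩ := List.mem_map.1 hy
    exact (hf l (ht l hl).1 (ht l hl).2).2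
  simp only [List.map_append, List.map_cons, List.prod_append, List.prod_cons, hmap s hs,
    hmap t ht, hmap v hv, hfa, hfb]
  unfold QComm at hb
  rw [hb, zpow_one]
  simp only [mul_assoc]
  rw [(hq (t.map f).prod).symm.left_comm, (hq (f a)).symm.left_comm,
    (hq (s.map f).prod).symm.left_comm, ← mul_assoc (t.map f).prod d, hcomm.eq,
    mul_assoc d]

/-- The total weight of a family of paths, as a unit. -/
def unitWeight {R : Type u} [Ring R] {m n k : ℕ} (D : QMData R m n)
    (P : Fin k → List (CVertex m n)) : Rˣ :=
  ((List.finRange k).map fun l => unitPathWeight D (P l)).prod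

theorem unitWeight_eq_and_invCount_eq {R : Type u} [Ring R] {m n k : ℕ} (D : QMData R m n)
    {white : Fin m → Fin n → Bool} (hC : IsCauchon white) {ι : Fin k → Fin m}
    {κ : Fin k → Fin n} (hκ : StrictMono κ) {σ : Equiv.Perm (Fin k)}
    {P P' : Fin k → List (CVertex m n)} (hP : IsSystem white ι (fun l => κ (σ l)) P)
    {i : Fin m} {c : Fin n} {a b : Fin k} (h : LastMeet P (.sq i c) a b) (hab : a < b)
    {A B K L : List (CVertex m n)} (hA : P a = A ++ .sq i c :: K) (hB : P b = B ++ .sq i c :: L)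
    (hKc : GPath white (.sq i c) (.col (κ (σ a))) (.sq i c :: K))
    (hLc : GPath white (.sq i c) (.col (κ (σ b))) (.sq i c :: L))
    (hBh : GPath white (.row (ι b)) (.sq i c) (B ++ [.sq i c]))
    (hK : GoesLeft white i c (κ (σ a)) K) (hL : GoesDown white i c (κ (σ b)) L)
    (hPa : P' a = A ++ .sq i c :: L) (hPb : P' b = B ++ .sq i c :: K)
    (hPl : ∀ l, l ≠ a → l ≠ b → P' l = P l) :
    unitWeight D P = D.q * unitWeight D P' ∧
      invCount (σ * Equiv.swap a b) = invCount σ + 1 := by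
  have hq := commute_q D
  have hdK : ∀ l, l ≠ a → ∀ y ∈ K, y ∉ P l := fun l hl => h.disjoint_tails hl.symm hA hKc
  have hdL : ∀ l, l ≠ b → ∀ y ∈ L, y ∉ P l := fun l hl => h.disjoint_tails hl.symm hB hLc
  have hx : ∀ l, l ≠ a → l ≠ b → (.sq i c : CVertex m n) ∉ P l := fun l h1 h2 => h.notMem hP h1 h2
  obtain ⟨o, hoc, hwc, hwo, hg, hKo⟩ := hK
  obtain ⟨w, hwcol, hwrow, hwe, hLw⟩ := hL
  have hinj : ∀ {l l'}, l ≠ l' → κ (σ l) ≠ κ (σ l') := fun h h' =>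
    h (σ.injective (hκ.injective h'))
  have hlt : κ (σ a) < κ (σ b) :=
    end_lt_end hC _ le_rfl hKo hLw
      (fun y hy hy' => hdK b h.1.symm y hy (by simp [hB, hy'])) hwrow.le (by rw [hwcol]; exact hoc)
  have hout : ∀ l, l ≠ a → l ≠ b → κ (σ l) < κ (σ a) ∨ κ (σ b) < κ (σ l) := fun l h1 h2 =>
    end_outside hC hwc hwo hg hKo hLc (hP l) (fun y hy hy' => hdK l h1 y hy' hy)
      (fun y hy hy' => by
        rcases List.mem_cons.1 hy' with rfl | hy'
        · exact hx l h1 h2 hy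
        · exact hdL l h2 y hy' hy) (.inr c.2)
  refine ⟨?_, invCount_mul_swap σ hab (hκ.lt_iff_lt.1 hlt) fun l h1 h2 =>
    (hout l h1 h2).imp hκ.lt_iff_lt.1 hκ.lt_iff_lt.1⟩
  have hnotrow : ∀ r, w ≠ .row r := by
    rintro r rfl
    cases hwe
  have hwL : unitPathWeight D (.sq i c :: L) = unitPathWeight D L := by
    rw [hLw.unitPathWeight_cons]
    cases hwe with
    | horiz => simp [posRow] at hwrow
    | toCol => simp [unitWt]
    | vert _ _ _ hlt' => simp [unitWt, hlt'.ne]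
  refine prod_eq_of_swap (d := (unitPathWeight D (.sq i c :: K))⁻¹ *
    unitPathWeight D (.sq i c :: L)) hq hab ?_ ?_ ?_ ?_
  · rw [hPa, hA, unitPathWeight_append, unitPathWeight_append D A K]
    group
  · rw [hPb, hB, unitPathWeight_append, unitPathWeight_append D B K]
    group
  · rw [hPb]
    have hp := hBh.append hKc
    have h1 := hp.qcomm_path D hKc (by simp) True (fun r s hrs => by simp_all)
    have h2 := hp.qcomm_path D hLw hnotrow False (fun r s hrs => by
      simp only [iff_false, List.mem_append]
      rintro (h' | h')
      · exact absurd (hBh.rank_lt_last _ h') (not_lt.2 (hLc.rank_lt _ hrs).le)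
      · exact hdL a h.1 _ hrs (by rw [hA]; exact List.mem_append_right _ h'))
    rw [hwcol] at h2
    rw [hwL]
    refine ((h1.inv_right hq).mul_right hq h2).congr ?_
    simp only [posCol, if_true, hlt.ne, if_false]
    by_cases h' : (κ (σ a) : ℕ) = c <;> simp [h']
  · intro l h1 h2
    refine ⟨by rw [hPl l h1 h2], ?_⟩
    have h3 := (hP l).qcomm_path D hKc (by simp) False (fun r s hrs => by
      simp only [iff_false]
      rcases List.mem_cons.1 hrs with h' | h'
      · rw [h']
        exact hx l h1 h2
      · exact hdK l h1 _ h')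
    have h4 := (hP l).qcomm_path D hLw hnotrow False (fun r s hrs => by
      simp only [iff_false]
      exact hdL l h2 _ hrs)
    rw [hwcol] at h4
    rw [hwL]
    have h5 := (((h3.inv_right hq).mul_right hq h4).congr (f := 0) (by
      simp only [posCol, hinj h1, hinj h2, if_false]
      by_cases h' : (κ (σ l) : ℕ) = c <;> simp [h']))
    rw [commute_iff_eq]
    simpa [QComm] using h5

/-- The family of paths obtained by exchanging the tails of `P a` and `P b` from `x` on. -/
def swapTails {m n k : ℕ} (P : Fin k → List (CVertex m n)) (x : CVertex m n) (a b : Fin k) :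
    Fin k → List (CVertex m n) := fun l =>
  (P l).takeWhile (fun y => decide (y ≠ x)) ++
    (P (Equiv.swap a b l)).dropWhile (fun y => decide (y ≠ x))

theorem takeWhile_dropWhile_append {α : Type*} [DecidableEq α] {A K : List α} {x : α}
    (h : x ∉ A) : (A ++ x :: K).takeWhile (fun y => decide (y ≠ x)) = A ∧
      (A ++ x :: K).dropWhile (fun y => decide (y ≠ x)) = x :: K := by
  have hA : ∀ y ∈ A, decide (y ≠ x) = true := by
    intro y hy
    simp only [ne_eq, decide_eq_true_eq]
    rintro rfl
    exact h hy
  constructor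
  · rw [List.takeWhile_append_of_pos hA]
    simp
  · rw [List.dropWhile_append_of_pos hA]
    simp

section swapTails

variable {m n k : ℕ} {P : Fin k → List (CVertex m n)} {x : CVertex m n} {a b : Fin k}
  {A B K L : List (CVertex m n)}

theorem swapTails_left (hA : P a = A ++ x :: K) (hB : P b = B ++ x :: L) (hxA : x ∉ A)
    (hxB : x ∉ B) : swapTails P x a b a = A ++ x :: L := by
  rw [swapTails, Equiv.swap_apply_left, hA, hB, (takeWhile_dropWhile_append hxA).1,
    (takeWhile_dropWhile_append hxB).2]

theorem swapTails_right (hA : P a = A ++ x :: K) (hB : P b = B ++ x :: L) (hxA : x ∉ A)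
    (hxB : x ∉ B) : swapTails P x a b b = B ++ x :: K := by
  rw [swapTails, Equiv.swap_apply_right, hA, hB, (takeWhile_dropWhile_append hxB).1,
    (takeWhile_dropWhile_append hxA).2]

theorem swapTails_of_ne {l : Fin k} (ha : l ≠ a) (hb : l ≠ b) : swapTails P x a b l = P l := by
  rw [swapTails, Equiv.swap_apply_of_ne_of_ne ha hb, List.takeWhile_append_dropWhile]

theorem swapTails_swapTails (hA : P a = A ++ x :: K) (hB : P b = B ++ x :: L) (hxA : x ∉ A)
    (hxB : x ∉ B) : swapTails (swapTails P x a b) x a b = P := by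
  have h1 := swapTails_left hA hB hxA hxB
  have h2 := swapTails_right hA hB hxA hxB
  funext l
  by_cases ha : l = a
  · rw [ha, swapTails_left h1 h2 hxA hxB, hA]
  · by_cases hb : l = b
    · rw [hb, swapTails_right h1 h2 hxA hxB, hB]
    · rw [swapTails_of_ne ha hb, swapTails_of_ne ha hb]

end swapTails

theorem LastMeet.exists_split {m n k : ℕ} {white : Fin m → Fin n → Bool} {ι : Fin k → Fin m}
    {τ : Fin k → Fin n} {P : Fin k → List (CVertex m n)} {x : CVertex m n} {a b : Fin k}
    (h : LastMeet P x a b) (hP : IsSystem white ι τ P) :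
    ∃ A B K L, P a = A ++ x :: K ∧ P b = B ++ x :: L ∧
      GPath white (.row (ι a)) x (A ++ [x]) ∧ GPath white (.row (ι b)) x (B ++ [x]) ∧
      GPath white x (.col (τ a)) (x :: K) ∧ GPath white x (.col (τ b)) (x :: L) := by
  obtain ⟨A, K, hA, h1, h2⟩ := (hP a).exists_split h.2.1
  obtain ⟨B, L, hB, h3, h4⟩ := (hP b).exists_split h.2.2.1
  exact ⟨A, B, K, L, hA, hB, h1, h3, h2, h4⟩

theorem LastMeet.isSystem_swapTails {m n k : ℕ} {white : Fin m → Fin n → Bool}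
    {ι : Fin k → Fin m} {τ : Fin k → Fin n} {P : Fin k → List (CVertex m n)} {x : CVertex m n}
    {a b : Fin k} (h : LastMeet P x a b) (hP : IsSystem white ι τ P) :
    IsSystem white ι (fun l => τ (Equiv.swap a b l)) (swapTails P x a b) := by
  obtain ⟨A, B, K, L, hA, hB, h1, h2, h3, h4⟩ := h.exists_split hP
  have hxA := h1.notMem_of_append
  have hxB := h2.notMem_of_append
  intro l
  change GPath white (.row (ι l)) (.col (τ (Equiv.swap a b l))) _
  by_cases ha : l = a
  · subst ha
    rw [swapTails_left hA hB hxA hxB, Equiv.swap_apply_left]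
    exact h1.append h4
  · by_cases hb : l = b
    · subst hb
      rw [swapTails_right hA hB hxA hxB, Equiv.swap_apply_right]
      exact h2.append h3
    · rw [swapTails_of_ne ha hb, Equiv.swap_apply_of_ne_of_ne ha hb]
      exact hP l

theorem LastMeet.swapTails {m n k : ℕ} {white : Fin m → Fin n → Bool}
    {ι : Fin k → Fin m} {τ : Fin k → Fin n} {P : Fin k → List (CVertex m n)} {x : CVertex m n}
    {a b : Fin k} (h : LastMeet P x a b) (hP : IsSystem white ι τ P) :
    LastMeet (swapTails P x a b) x a b := by
  obtain ⟨A, B, K, L, hA, hB, h1, h2, h3, h4⟩ := h.exists_split hP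
  have hxA := h1.notMem_of_append
  have hxB := h2.notMem_of_append
  have hPa := swapTails_left hA hB hxA hxB
  have hPb := swapTails_right hA hB hxA hxB
  refine ⟨h.1, by simp [hPa], by simp [hPb], ?_⟩
  intro c d y hcd hc hd
  by_contra! hy
  have key : ∀ l, y ∈ CauchonGraph.swapTails P x a b l → y ∈ P (Equiv.swap a b l) := by
    intro l hl
    by_cases ha : l = a
    · subst ha
      rw [hPa] at hl
      rw [Equiv.swap_apply_left, hB]
      rcases List.mem_append.1 hl with hl | hl
      · exact absurd (h1.rank_lt_last y hl) (not_lt.2 hy.le)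
      · exact List.mem_append_right _ hl
    · by_cases hb : l = b
      · subst hb
        rw [hPb] at hl
        rw [Equiv.swap_apply_right, hA]
        rcases List.mem_append.1 hl with hl | hl
        · exact absurd (h2.rank_lt_last y hl) (not_lt.2 hy.le)
        · exact List.mem_append_right _ hl
      · rw [swapTails_of_ne ha hb] at hl
        rwa [Equiv.swap_apply_of_ne_of_ne ha hb]
  exact absurd (h.2.2.2 _ _ y ((Equiv.swap a b).injective.ne hcd) (key c hc) (key d hd))
    (not_le.2 hy)

/-! ### The sign-reversing involution -/

theorem coe_unitWeight {R : Type u} [Ring R] {m n k : ℕ} (D : QMData R m n)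
    (P : Fin k → List (CVertex m n)) :
    (unitWeight D P : R) = ((List.finRange k).map fun l => pathWeight D (P l)).prod := by
  rw [unitWeight, ← Units.coeHom_apply, map_list_prod, List.map_map]
  simp only [Function.comp_def, Units.coeHom_apply, coe_unitPathWeight]

theorem LastMeet.signed_weight_add_eq_zero {R : Type u} [Ring R] {m n k : ℕ} (D : QMData R m n)
    {white : Fin m → Fin n → Bool} (hC : IsCauchon white) {ι : Fin k → Fin m}
    {κ : Fin k → Fin n} (hι : StrictMono ι) (hκ : StrictMono κ) {σ : Equiv.Perm (Fin k)}
    {P : Fin k → List (CVertex m n)} (hP : IsSystem white ι (fun l => κ (σ l)) P)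
    {x : CVertex m n} {a b : Fin k} (h : LastMeet P x a b) (hab : a < b) :
    (-(D.q : R)) ^ invCount σ * (unitWeight D P : R) +
      (-(D.q : R)) ^ invCount (σ * Equiv.swap a b) *
        (unitWeight D (CauchonGraph.swapTails P x a b) : R) = 0 := by
  obtain ⟨i, c, rfl⟩ := h.exists_eq_sq hP hι.injective (hκ.injective.comp σ.injective)
  obtain ⟨A, B, K, L, hA, hB, h1, h2, h3, h4⟩ := h.exists_split hP
  have hxA := h1.notMem_of_append
  have hxB := h2.notMem_of_append
  have hPa := swapTails_left hA hB hxA hxB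
  have hPb := swapTails_right hA hB hxA hxB
  have hcancel : ∀ (N : ℕ) (w : R),
      (-(D.q : R)) ^ N * ((D.q : R) * w) + (-(D.q : R)) ^ (N + 1) * w = 0 := by
    intro N w
    rw [pow_succ, mul_assoc, neg_mul, mul_neg, add_neg_cancel]
  rcases h3.goesLeft_or_goesDown with hK | hK <;> rcases h4.goesLeft_or_goesDown with hL | hL
  · exact (h.not_both h.1 hA hB h3 (hK.exists_common hL)).elim
  · obtain ⟨hw, hs⟩ := unitWeight_eq_and_invCount_eq D hC hκ hP h hab hA hB h3 h4 h2 hK hL hPa hPb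
      fun l ha hb => swapTails_of_ne ha hb
    rw [hw, hs, Units.val_mul]
    exact hcancel _ _
  · have hσa : (σ * Equiv.swap a b) a = σ b := by simp
    have hσb : (σ * Equiv.swap a b) b = σ a := by simp
    obtain ⟨hw, hs⟩ := unitWeight_eq_and_invCount_eq D hC hκ (σ := σ * Equiv.swap a b)
      (h.isSystem_swapTails hP) (h.swapTails hP) hab hPa hPb (by rwa [hσa]) (by rwa [hσb]) h2
      (by rwa [hσa]) (by rwa [hσb]) hA hB fun l ha hb => (swapTails_of_ne ha hb).symm
    rw [mul_assoc, Equiv.swap_mul_self, mul_one] at hs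
    rw [hw, hs, Units.val_mul, add_comm]
    exact hcancel _ _
  · exact (h.not_both h.1 hA hB h3 (hK.exists_common hL)).elim

theorem prod_map_finRange_sum {R : Type*} [Ring R] {k : ℕ} {α : Fin k → Type*}
    [∀ i, Fintype (α i)] (f : ∀ i, α i → R) :
    ((List.finRange k).map fun i => ∑ a, f i a).prod =
      ∑ x : ∀ i, α i, ((List.finRange k).map fun i => f i (x i)).prod := by
  induction k with
  | zero => simp
  | succ k ih =>
    rw [List.finRange_succ, List.map_cons, List.prod_cons, List.map_map]
    have h := ih (α := fun i => α i.succ) (fun i => f i.succ)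
    simp only [Function.comp_def]
    rw [h, Finset.sum_mul_sum, ← Fintype.sum_prod_type']
    refine Fintype.sum_equiv (Fin.consEquiv α) _ _ fun x => ?_
    simp [Function.comp_def]

/-- The vertices of the Cauchon graph as a disjoint union. -/
def vertexEquiv (m n : ℕ) : CVertex m n ≃ (Fin m × Fin n) ⊕ (Fin m ⊕ Fin n) where
  toFun
    | .sq i j => .inl (i, j)
    | .row i => .inr (.inl i)
    | .col j => .inr (.inr j)
  invFun
    | .inl (i, j) => .sq i j
    | .inr (.inl i) => .row i
    | .inr (.inr j) => .col j
  left_inv v := by cases v <;> rfl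
  right_inv v := by rcases v with ⟨i, j⟩ | i | j <;> rfl

theorem finite_paths {m n : ℕ} (white : Fin m → Fin n → Bool) (u v : CVertex m n) :
    Finite {l : List (CVertex m n) // IsPathFrom white u v l} := by
  have : Fintype (CVertex m n) := Fintype.ofEquiv _ (vertexEquiv m n).symm
  have : Finite {l : List (CVertex m n) // l.Nodup} := inferInstance
  exact Finite.of_injective
    (fun l => (⟨l.1, (isPathFrom_iff.1 l.2).nodup⟩ : {l : List (CVertex m n) // l.Nodup}))
    fun l l' h => by
      simpa [Subtype.ext_iff] using h

/-- A path system is a permutation together with a choice of paths. -/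
def pathSysEquiv {m n : ℕ} (white : Fin m → Fin n → Bool) {k : ℕ} (ι : Fin k → Fin m)
    (κ : Fin k → Fin n) : (Σ σ : Equiv.Perm (Fin k), ∀ l : Fin k,
      {p : List (CVertex m n) // IsPathFrom white (.row (ι l)) (.col (κ (σ l))) p}) ≃
      PathSys white ι κ where
  toFun p := ⟨p.1, fun l => (p.2 l).1, fun l => (p.2 l).2⟩
  invFun S := ⟨S.σ, fun l => ⟨S.P l, S.isPath l⟩⟩
  left_inv _ := rfl
  right_inv _ := rfl

theorem qdet_eq_sum_pathSys {R : Type u} [Ring R] {m n : ℕ} (D : QMData R m n)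
    (white : Fin m → Fin n → Bool) {k : ℕ} (ι : Fin k → Fin m) (κ : Fin k → Fin n)
    [Fintype (PathSys white ι κ)] :
    qdet D.q (Matrix.of fun a b : Fin k => pathMatrix D white (ι a) (κ b)) =
      ∑ S : PathSys white ι κ, S.sgnq D * S.weight D := by
  classical
  have := fun u v => finite_paths white u v
  let := fun u v => Fintype.ofFinite {l : List (CVertex m n) // IsPathFrom white u v l}
  rw [← Fintype.sum_equiv (pathSysEquiv white ι κ) _ _ fun p => rfl, Fintype.sum_sigma, qdet]
  refine Finset.sum_congr rfl fun σ _ => ?_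
  simp only [pathMatrix, Matrix.of_apply, finsum_eq_sum_of_fintype]
  rw [prod_map_finRange_sum, Finset.mul_sum]
  rfl

theorem invCount_eq_zero_of_vertexDisjoint {m n : ℕ} {white : Fin m → Fin n → Bool}
    (hC : IsCauchon white) {k : ℕ} {ι : Fin k → Fin m} {κ : Fin k → Fin n} (hι : StrictMono ι)
    (hκ : StrictMono κ) {S : PathSys white ι κ} (hS : S.VertexDisjoint) : invCount S.σ = 0 := by
  rw [invCount, Finset.card_eq_zero, Finset.filter_eq_empty_iff]
  rintro ⟨a, b⟩ - ⟨hab, hlt⟩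
  dsimp only at hab hlt
  have ha := isPathFrom_iff.1 (S.isPath a)
  have hb := isPathFrom_iff.1 (S.isPath b)
  have hd := hS a b hab.ne
  generalize S.P a = p at ha hd
  cases ha with
  | cons ed h =>
    cases ed with
    | fromRow _ c =>
      exact absurd (hκ hlt) (not_lt.2 (end_lt_end hC _ le_rfl h hb
        (fun y hy hy' => hd y (List.mem_cons_of_mem _ hy) hy') (hι hab).le c.2).le)

theorem sum_not_vertexDisjoint {R : Type u} [Ring R] {m n : ℕ} (D : QMData R m n)
    {white : Fin m → Fin n → Bool} (hC : IsCauchon white) {k : ℕ} {ι : Fin k → Fin m}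
    {κ : Fin k → Fin n} (hι : StrictMono ι) (hκ : StrictMono κ) [Fintype (PathSys white ι κ)]
    [DecidablePred fun S : PathSys white ι κ => ¬ S.VertexDisjoint] :
    ∑ S : PathSys white ι κ with ¬ S.VertexDisjoint, S.sgnq D * S.weight D = 0 := by
  classical
  set s := (Finset.univ : Finset (PathSys white ι κ)).filter fun S => ¬ S.VertexDisjoint with hs
  have hmem : ∀ {S}, S ∈ s ↔ ¬ S.VertexDisjoint := fun {S} => by simp [hs]
  have hex : ∀ S ∈ s, ∃ y : CVertex m n × Fin k × Fin k,
      y.2.1 < y.2.2 ∧ LastMeet S.P y.1 y.2.1 y.2.2 := by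
    intro S hS
    rw [hmem, PathSys.VertexDisjoint] at hS
    push Not at hS
    obtain ⟨a, b, hab, x, hxa, hxb, -⟩ := hS
    obtain ⟨x, a, b, h⟩ := exists_lastMeet ⟨a, b, hab, x, hxa, hxb⟩
    exact ⟨(x, a, b), h⟩
  have hsys : ∀ S : PathSys white ι κ, IsSystem white ι (fun l => κ (S.σ l)) S.P :=
    fun S l => isPathFrom_iff.1 (S.isPath l)
  choose y hylt hy using hex
  let g : ∀ S ∈ s, PathSys white ι κ := fun S hS =>
    ⟨S.σ * Equiv.swap (y S hS).2.1 (y S hS).2.2,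
      swapTails S.P (y S hS).1 (y S hS).2.1 (y S hS).2.2,
      fun l => isPathFrom_iff.2 ((hy S hS).isSystem_swapTails (hsys S) l)⟩
  have hg : ∀ S hS, LastMeet (g S hS).P (y S hS).1 (y S hS).2.1 (y S hS).2.2 := fun S hS =>
    (hy S hS).swapTails (hsys S)
  have hg' : ∀ S hS, g S hS ∈ s := fun S hS => hmem.2 fun h =>
    h _ _ (hg S hS).1 _ (hg S hS).2.1 (hg S hS).2.2.1
  refine Finset.sum_involution g ?_ ?_ hg' ?_
  · intro S hS
    have := (hy S hS).signed_weight_add_eq_zero D hC hι hκ (hsys S) (hylt S hS)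
    simp only [coe_unitWeight] at this
    exact this
  · intro S hS _ h
    have h1 : S.σ * Equiv.swap (y S hS).2.1 (y S hS).2.2 = S.σ := congrArg PathSys.σ h
    rw [mul_eq_left, Equiv.swap_eq_one_iff] at h1
    exact (hy S hS).1 h1
  · intro S hS
    have hu := (hy _ (hg' S hS)).unique (hylt _ (hg' S hS)) (hg S hS) (hylt S hS)
      (hsys _) hι.injective (hκ.injective.comp (Equiv.injective _))
    obtain ⟨A, B, K, L, hA, hB, h1, h2, -, -⟩ := (hy S hS).exists_split (hsys S)
    have hP := swapTails_swapTails hA hB h1.notMem_of_append h2.notMem_of_append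
    have key : ∀ T : PathSys white ι κ, T.σ = S.σ → T.P = S.P → T = S := by
      rintro ⟨σ, P, hT⟩ rfl rfl
      rfl
    refine key _ ?_ ?_
    · change S.σ * Equiv.swap (y S hS).2.1 (y S hS).2.2 *
        Equiv.swap (y (g S hS) (hg' S hS)).2.1 (y (g S hS) (hg' S hS)).2.2 = S.σ
      rw [hu.2.1, hu.2.2, mul_assoc, Equiv.swap_mul_self, mul_one]
    · change swapTails (swapTails S.P (y S hS).1 (y S hS).2.1 (y S hS).2.2)
        (y (g S hS) (hg' S hS)).1 (y (g S hS) (hg' S hS)).2.1 (y (g S hS) (hg' S hS)).2.2 = S.P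
      rw [hu.1, hu.2.1, hu.2.2, hP]

end CauchonGraph

/-- q-analogue of Lindström's Lemma: `det_q(M_C[I,J])` equals
the sum of the weights of all vertex-disjoint `(R_I, C_J)`-path systems. -/
theorem qdet_eq_sum_disjoint_path_systems {R : Type u} [Ring R] {m n : ℕ} (D : QMData R m n)
    (white : Fin m → Fin n → Bool) (hC : IsCauchon white)
    {k : ℕ} (ι : Fin k → Fin m) (κ : Fin k → Fin n)
    (hι : StrictMono ι) (hκ : StrictMono κ) :
    qdet D.q (Matrix.of fun a b : Fin k => pathMatrix D white (ι a) (κ b)) =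
      ∑ᶠ S : {S : PathSys white ι κ // S.VertexDisjoint}, S.1.weight D := by
  classical
  have : Finite (PathSys white ι κ) :=
    have := fun u v => CauchonGraph.finite_paths white u v
    Finite.of_equiv _ (CauchonGraph.pathSysEquiv white ι κ)
  let := Fintype.ofFinite (PathSys white ι κ)
  rw [CauchonGraph.qdet_eq_sum_pathSys, finsum_eq_sum_of_fintype,
    ← Finset.sum_filter_add_sum_filter_not _ fun S : PathSys white ι κ => S.VertexDisjoint,
    CauchonGraph.sum_not_vertexDisjoint D hC hι hκ, add_zero,
    ← Finset.sum_subtype_eq_sum_filter, Finset.subtype_univ]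
  refine Finset.sum_congr rfl fun S _ => ?_
  rw [PathSys.sgnq, CauchonGraph.invCount_eq_zero_of_vertexDisjoint hC hι hκ S.2, pow_zero,
    one_mul]
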